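/- arXiv:2006.16576 — 3 statements merged into one kernel-verified Lean document; each statement's English description precedes it below -/
import Mathlib

section
/- Set q^(∞) = ⋂_{p≥0} q^(p) and f = q + σ(q^(∞)). Then f is a complex Lie subalgebra of g with q ⊆ f ⊆ q + σ(q), and f is the largest such subalgebra: every complex Lie subalgebra f' of g satisfying q ⊆ f' ⊆ q + σ(q) is contained in f. -/
open Pointwise

/-- A conjugation of a complex Lie algebra `g`: an involutive, additive,
conjugate-linear map commuting with the bracket. -/
structure Conjugation (g : Type*) [LieRing g] [LieAlgebra ℂ g] where
  toFun : g → g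
  involutive : ∀ x, toFun (toFun x) = x
  map_add' : ∀ x y, toFun (x + y) = toFun x + toFun y
  map_smul' : ∀ (c : ℂ) (x : g), toFun (c • x) = (starRingEnd ℂ) c • toFun x
  map_bracket' : ∀ x y, toFun ⁅x, y⁆ = ⁅toFun x, toFun y⁆

variable {g : Type*} [LieRing g] [LieAlgebra ℂ g]

/-- The descending Levi chain of `(g, σ, q)`:
`q⁽⁰⁾ = q` and `q⁽ᵖ⁾ = {Z ∈ q⁽ᵖ⁻¹⁾ : [Z, σ(q)] ⊆ q⁽ᵖ⁻¹⁾ + σ(q)}`. -/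
def leviChain (σ : Conjugation g) (q : LieSubalgebra ℂ g) : ℕ → Set g
  | 0 => (q : Set g)
  | p + 1 =>
      {Z ∈ leviChain σ q p |
        ∀ W ∈ σ.toFun '' (q : Set g), ⁅Z, W⁆ ∈ leviChain σ q p + σ.toFun '' (q : Set g)}

/-- The image of a complex Lie subalgebra under a conjugation. -/
def Conjugation.map (σ : Conjugation g) (s : LieSubalgebra ℂ g) : LieSubalgebra ℂ g where
  carrier := σ.toFun '' (s : Set g)
  add_mem' := by
    rintro _ _ ⟨a, ha, rfl⟩ ⟨b, hb, rfl⟩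
    exact ⟨a + b, s.add_mem ha hb, σ.map_add' a b⟩
  zero_mem' := ⟨0, s.zero_mem, by simpa using σ.map_smul' 0 0⟩
  smul_mem' := by
    rintro c _ ⟨a, ha, rfl⟩
    exact ⟨(starRingEnd ℂ) c • a, s.smul_mem _ ha, by simp [σ.map_smul']⟩
  lie_mem' := by
    rintro _ _ ⟨a, ha, rfl⟩ ⟨b, hb, rfl⟩
    exact ⟨⁅a, b⁆, s.lie_mem ha hb, σ.map_bracket' a b⟩

theorem Conjugation.coe_map (σ : Conjugation g) (s : LieSubalgebra ℂ g) :
    (σ.map s : Set g) = σ.toFun '' (s : Set g) := rfl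

/-- Each term of the descending Levi chain is a complex Lie subalgebra. -/
theorem exists_coe_eq_leviChain (σ : Conjugation g) (q : LieSubalgebra ℂ g) (p : ℕ) :
    ∃ s : LieSubalgebra ℂ g, (s : Set g) = leviChain σ q p := by
  induction p with
  | zero => exact ⟨q, rfl⟩
  | succ p ih =>
    obtain ⟨s, hs⟩ := ih
    have key : ∀ Z, Z ∈ leviChain σ q (p + 1) ↔
        Z ∈ s ∧ ∀ W ∈ σ.map q, ⁅Z, W⁆ ∈ s.toSubmodule ⊔ (σ.map q).toSubmodule := by
      intro Z
      simp only [leviChain, ← hs, ← σ.coe_map, Submodule.mem_sup, Set.mem_add, Set.mem_ofPred_eq,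
        SetLike.mem_coe, LieSubalgebra.mem_toSubmodule]
    refine ⟨{ carrier := leviChain σ q (p + 1), add_mem' := ?_, zero_mem' := ?_,
              smul_mem' := ?_, lie_mem' := ?_ }, rfl⟩
    · intro a b ha hb
      rw [key] at ha hb ⊢
      refine ⟨s.add_mem ha.1 hb.1, fun W hW => ?_⟩
      rw [add_lie]
      exact Submodule.add_mem _ (ha.2 W hW) (hb.2 W hW)
    · rw [key]
      exact ⟨s.zero_mem, fun W _ => by simp⟩
    · intro c a ha
      rw [key] at ha ⊢
      refine ⟨s.smul_mem c ha.1, fun W hW => ?_⟩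
      rw [smul_lie]
      exact Submodule.smul_mem _ c (ha.2 W hW)
    · intro a b ha hb
      change a ∈ leviChain σ q (p + 1) at ha
      change b ∈ leviChain σ q (p + 1) at hb
      rw [key] at ha hb ⊢
      refine ⟨s.lie_mem ha.1 hb.1, fun W hW => ?_⟩
      have aux : ∀ x ∈ s, (∀ W ∈ σ.map q, ⁅x, W⁆ ∈ s.toSubmodule ⊔ (σ.map q).toSubmodule) →
          ∀ y ∈ s.toSubmodule ⊔ (σ.map q).toSubmodule,
            ⁅x, y⁆ ∈ s.toSubmodule ⊔ (σ.map q).toSubmodule := by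
        intro x hx hxW y hy
        obtain ⟨u, hu, v, hv, rfl⟩ := Submodule.mem_sup.1 hy
        rw [lie_add]
        exact Submodule.add_mem _ (Submodule.mem_sup_left (s.lie_mem hx hu)) (hxW v hv)
      rw [lie_lie]
      exact Submodule.sub_mem _ (aux a ha.1 ha.2 _ (hb.2 W hW)) (aux b hb.1 hb.2 _ (ha.2 W hW))

/-- The intersection of the descending Levi chain is a complex Lie subalgebra. -/
theorem exists_coe_eq_iInter_leviChain (σ : Conjugation g) (q : LieSubalgebra ℂ g) :
    ∃ s : LieSubalgebra ℂ g, (s : Set g) = ⋂ p : ℕ, leviChain σ q p := by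
  choose s hs using exists_coe_eq_leviChain σ q
  refine ⟨sInf (Set.range s), ?_⟩
  simp [LieSubalgebra.coe_sInf, hs]

theorem inter_subset_leviChain (σ : Conjugation g) (q : LieSubalgebra ℂ g) (p : ℕ) :
    (q : Set g) ∩ σ.map q ⊆ leviChain σ q p := by
  induction p with
  | zero => exact Set.inter_subset_left
  | succ p ih =>
    rintro Z hZ
    refine ⟨ih hZ, fun W hW => Set.mem_add.2 ⟨0, ih ⟨q.zero_mem, (σ.map q).zero_mem⟩,
      ⁅Z, W⁆, (σ.map q).lie_mem hZ.2 hW, zero_add _⟩⟩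

theorem leviChain_subset (σ : Conjugation g) (q : LieSubalgebra ℂ g) (p : ℕ) :
    leviChain σ q p ⊆ q := by
  induction p with
  | zero => exact subset_rfl
  | succ p ih => exact fun Z hZ => ih hZ.1

/-- Since every term of the chain contains `q ∩ σ(q)`, intersecting the chain commutes with
adding `σ(q)`; no finiteness of dimension is needed. -/
theorem lie_mem_iInter_leviChain_add (σ : Conjugation g) (q : LieSubalgebra ℂ g) {Z W : g}
    (hZ : Z ∈ ⋂ p : ℕ, leviChain σ q p) (hW : W ∈ σ.map q) :
    ⁅Z, W⁆ ∈ (⋂ p : ℕ, leviChain σ q p) + (σ.map q : Set g) := by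
  rw [Set.mem_iInter] at hZ
  have h : ∀ p, ⁅Z, W⁆ ∈ leviChain σ q p + (σ.map q : Set g) := fun p => (hZ (p + 1)).2 W hW
  obtain ⟨a, ha, b, hb, hab⟩ := Set.mem_add.1 (h 0)
  refine Set.mem_add.2 ⟨a, Set.mem_iInter.2 fun p => ?_, b, hb, hab⟩
  obtain ⟨a', ha', b', hb', hab'⟩ := Set.mem_add.1 (h p)
  obtain ⟨s, hs⟩ := exists_coe_eq_leviChain σ q p
  have hd : a - a' = b' - b := by
    rw [sub_eq_sub_iff_add_eq_add, hab, add_comm b' a', hab']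
  have hmem : a - a' ∈ leviChain σ q p := inter_subset_leviChain σ q p
    ⟨q.sub_mem ha (leviChain_subset σ q p ha'), hd ▸ (σ.map q).sub_mem hb' hb⟩
  rw [← hs] at hmem ha' ⊢
  simpa using s.add_mem hmem ha'

/-- Every term of the chain contains the elements of `q` whose conjugates lie in a given
subalgebra between `q` and `q + σ(q)`. -/
theorem mem_leviChain_of_map_mem (σ : Conjugation g) (q f' : LieSubalgebra ℂ g)
    (hq : (q : Set g) ⊆ f') (hf' : (f' : Set g) ⊆ (q : Set g) + σ.toFun '' (q : Set g)) (p : ℕ) :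
    ∀ b ∈ q, σ.toFun b ∈ f' → b ∈ leviChain σ q p := by
  induction p with
  | zero => exact fun b hb _ => hb
  | succ p ih =>
    intro b hb hbf
    refine ⟨ih b hb hbf, ?_⟩
    rintro _ ⟨w, hw, rfl⟩
    have hlie : ⁅σ.toFun b, w⁆ ∈ f' := f'.lie_mem hbf (hq hw)
    obtain ⟨a, ha, _, ⟨c, hc, rfl⟩, hac⟩ := Set.mem_add.1 (hf' hlie)
    have hcf : σ.toFun c ∈ f' := by
      have := f'.sub_mem hlie (hq ha)
      rwa [← hac, add_sub_cancel_left] at this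
    refine Set.mem_add.2 ⟨c, ih c hc hcf, σ.toFun a, ⟨a, ha, rfl⟩, ?_⟩
    have := congrArg σ.toFun hac
    rw [σ.map_add', σ.map_bracket', σ.involutive, σ.involutive] at this
    rw [← this, add_comm]

/-- With `q⁽∞⁾ = ⋂ₚ q⁽ᵖ⁾` and `f = q + σ(q⁽∞⁾)`, the set `f` is a complex Lie
subalgebra of `g` with `q ⊆ f ⊆ q + σ(q)`, and it is the largest such subalgebra. -/
theorem leviChain_inf_largest_subalgebra (σ : Conjugation g) (q : LieSubalgebra ℂ g) :
    (∃ s : LieSubalgebra ℂ g,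
        (s : Set g) = (q : Set g) + σ.toFun '' (⋂ p : ℕ, leviChain σ q p)) ∧
      (q : Set g) ⊆ (q : Set g) + σ.toFun '' (⋂ p : ℕ, leviChain σ q p) ∧
      (q : Set g) + σ.toFun '' (⋂ p : ℕ, leviChain σ q p) ⊆
        (q : Set g) + σ.toFun '' (q : Set g) ∧
      ∀ f' : LieSubalgebra ℂ g,
        (q : Set g) ⊆ (f' : Set g) →
        (f' : Set g) ⊆ (q : Set g) + σ.toFun '' (q : Set g) →
        (f' : Set g) ⊆ (q : Set g) + σ.toFun '' (⋂ p : ℕ, leviChain σ q p) := by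
  obtain ⟨t, ht⟩ := exists_coe_eq_iInter_leviChain σ q
  have hcross : ∀ a ∈ q, ∀ b ∈ σ.map t, ⁅b, a⁆ ∈ q.toSubmodule ⊔ (σ.map t).toSubmodule := by
    rintro a ha _ ⟨z, hz, rfl⟩
    rw [ht] at hz
    obtain ⟨u, hu, _, ⟨v, hv, rfl⟩, huv⟩ :=
      Set.mem_add.1 (lie_mem_iInter_leviChain_add σ q hz ⟨a, ha, rfl⟩)
    rw [← ht] at hu
    have := congrArg σ.toFun huv
    rw [σ.map_add', σ.map_bracket', σ.involutive, σ.involutive] at this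
    rw [← this, add_comm]
    exact Submodule.mem_sup.2 ⟨v, hv, _, ⟨u, hu, rfl⟩, rfl⟩
  refine ⟨⟨{ q.toSubmodule ⊔ (σ.map t).toSubmodule with lie_mem' := ?_ }, ?_⟩, ?_, ?_, ?_⟩
  · intro x y hx hy
    obtain ⟨a, ha, b, hb, rfl⟩ := Submodule.mem_sup.1 hx
    obtain ⟨c, hc, d, hd, rfl⟩ := Submodule.mem_sup.1 hy
    change ⁅a + b, c + d⁆ ∈ q.toSubmodule ⊔ (σ.map t).toSubmodule
    rw [add_lie, lie_add, lie_add, ← lie_skew a d]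
    exact Submodule.add_mem _
      (Submodule.add_mem _ (Submodule.mem_sup_left (q.lie_mem ha hc))
        (Submodule.neg_mem _ (hcross a ha d hd)))
      (Submodule.add_mem _ (hcross c hc b hb)
        (Submodule.mem_sup_right ((σ.map t).lie_mem hb hd)))
  · rw [← ht]
    exact Submodule.coe_sup q.toSubmodule (σ.map t).toSubmodule
  · intro x hx
    rw [← ht]
    exact Set.mem_add.2 ⟨x, hx, 0, (σ.map t).zero_mem, add_zero x⟩
  · exact Set.add_subset_add_left (Set.image_mono (Set.iInter_subset (leviChain σ q) 0))
  · intro f' hq hf' x hx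
    obtain ⟨a, ha, _, ⟨b, hb, rfl⟩, rfl⟩ := Set.mem_add.1 (hf' hx)
    have hbf : σ.toFun b ∈ f' := by
      have := f'.sub_mem hx (hq ha)
      rwa [add_sub_cancel_left] at this
    exact Set.mem_add.2 ⟨a, ha, _,
      ⟨b, Set.mem_iInter.2 fun p => mem_leviChain_of_map_mem σ q f' hq hf' p b hb hbf, rfl⟩, rfl⟩
end

section
/- Suppose β ∈ Q with σ(β) ∉ Q has finite Levi order k = q^σ(β), and let α_1,…,α_k be a Levi chain of length k for β. Then: (i) α_i ∉ Q (i.e. ξ(α_i) > 0) for every 1 ≤ i ≤ k; (ii) for every h < k the partial sum γ_h = β + α_1 + ⋯ + α_h satisfies γ_h ∈ Q and σ(γ_h) ∉ Q; (iii) for every permutation τ of {1,…,k}, the sequence α_{τ(1)},…,α_{τ(k)} is again a Levi chain of length k for β; (iv) α_i + α_j ∉ R for all 1 ≤ i < j ≤ k. -/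
open RealInnerProductSpace

variable {V : Type*} [NormedAddCommGroup V] [InnerProductSpace ℝ V]

/-- `R` is a reduced crystallographic root system in `V`. -/
def IsRootSystem (R : Set V) : Prop :=
  R.Finite ∧ (0 : V) ∉ R ∧
    (∀ α ∈ R, ∀ β ∈ R,
      (∃ n : ℤ, 2 * ⟪β, α⟫ / ⟪α, α⟫ = (n : ℝ)) ∧
        β - (2 * ⟪β, α⟫ / ⟪α, α⟫) • α ∈ R) ∧
    ∀ α ∈ R, ∀ t : ℝ, t • α ∈ R → t = 1 ∨ t = -1

/-- The partial sum `β + α₁ + ⋯ + α_h` of the first `h` terms of a sequence. -/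
def partialSum (β : V) {k : ℕ} (α : Fin k → V) (h : ℕ) : V :=
  β + ∑ i ∈ Finset.univ.filter (fun i : Fin k => (i : ℕ) < h), α i

/-- `α` is a Levi chain of length `k` for `β`: all `σ(αᵢ) ∈ Q`, all partial sums
`β + α₁ + ⋯ + α_h` (`1 ≤ h ≤ k`) are roots, and the final sum `γ` satisfies
`γ ∉ Q` and `σ(γ) ∉ Q`. -/
def IsLeviChain (R Q : Set V) (σ : V →ₗ[ℝ] V) (β : V) {k : ℕ} (α : Fin k → V) : Prop :=
  (∀ i, α i ∈ R ∧ σ (α i) ∈ Q) ∧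
    (∀ h : ℕ, 1 ≤ h → h ≤ k → partialSum β α h ∈ R) ∧
    partialSum β α k ∉ Q ∧ σ (partialSum β α k) ∉ Q

/-- The Levi order `q^σ(β)`: the minimal length of a Levi chain for `β`,
or `⊤` if no Levi chain for `β` exists. -/
noncomputable def leviOrder (R Q : Set V) (σ : V →ₗ[ℝ] V) (β : V) : ℕ∞ :=
  sInf {m : ℕ∞ | ∃ (k : ℕ) (α : Fin k → V), m = (k : ℕ∞) ∧ IsLeviChain R Q σ β α}

open RealInnerProductSpace in
theorem IsRootSystem.neg_mem {V : Type*} [NormedAddCommGroup V] [InnerProductSpace ℝ V]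
    {R : Set V} (hR : IsRootSystem R) {x : V} (hx : x ∈ R) : -x ∈ R := by
  have h := (hR.2.2.1 x hx x hx).2
  have hx0 : x ≠ 0 := fun h0 => hR.2.1 (h0 ▸ hx)
  have hxx : ⟪x, x⟫ ≠ 0 := inner_self_ne_zero.mpr hx0
  rw [mul_div_assoc, div_self hxx, mul_one, two_smul] at h
  simpa using h

open RealInnerProductSpace in
theorem IsRootSystem.sub_mem_of_inner_pos {V : Type*} [NormedAddCommGroup V]
    [InnerProductSpace ℝ V] {R : Set V} (hR : IsRootSystem R) {x y : V} (hx : x ∈ R)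
    (hy : y ∈ R) (hxy : 0 < ⟪x, y⟫) : x - y = 0 ∨ x - y ∈ R := by
  have pos : ∀ z ∈ R, 0 < ⟪z, z⟫ := fun z hz =>
    real_inner_self_pos.mpr fun h0 => hR.2.1 (h0 ▸ hz)
  have key : ∀ u ∈ R, ∀ v ∈ R, 0 < ⟪u, v⟫ → u - v ∈ R ∨ ⟪v, v⟫ ≤ ⟪u, v⟫ := by
    intro u hu v hv huv
    obtain ⟨⟨n, hn⟩, hmem⟩ := hR.2.2.1 v hv u hu
    have hvv := pos v hv
    have hn0 : (0 : ℝ) < n := hn ▸ by positivity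
    have hn1 : 1 ≤ n := by exact_mod_cast hn0
    obtain rfl | hn2 : n = 1 ∨ 2 ≤ n := by omega
    · left
      rwa [hn, Int.cast_one, one_smul] at hmem
    · right
      have hn2' : (2 : ℝ) ≤ n := by exact_mod_cast hn2
      rw [← hn, le_div_iff₀ hvv] at hn2'
      linarith
  obtain h | h₁ := key x hx y hy hxy
  · exact .inr h
  obtain h | h₂ := key y hy x hx (by rwa [real_inner_comm])
  · right
    simpa using hR.neg_mem h
  · left
    rw [real_inner_comm x y] at h₂
    by_contra hne
    have := real_inner_self_pos.mpr hne
    rw [real_inner_sub_sub_self] at this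
    linarith

open RealInnerProductSpace in
theorem IsRootSystem.add_mem_of_inner_neg {V : Type*} [NormedAddCommGroup V]
    [InnerProductSpace ℝ V] {R : Set V} (hR : IsRootSystem R) {x y : V} (hx : x ∈ R)
    (hy : y ∈ R) (hxy : ⟪x, y⟫ < 0) : x + y = 0 ∨ x + y ∈ R := by
  simpa using hR.sub_mem_of_inner_pos hx (hR.neg_mem hy) (by simpa using hxy)

open RealInnerProductSpace in
/-- If `x`, `a`, `b`, `x + a` and `x + a + b` are roots, then one of `x + b`, `a + b` is a root
or zero. -/
theorem IsRootSystem.add_mem_or_add_mem {V : Type*} [NormedAddCommGroup V]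
    [InnerProductSpace ℝ V] {R : Set V} (hR : IsRootSystem R) {x a b : V} (hx : x ∈ R)
    (ha : a ∈ R) (hb : b ∈ R) (hxa : x + a ∈ R) (hxab : x + a + b ∈ R) :
    (x + b = 0 ∨ x + b ∈ R) ∨ (a + b = 0 ∨ a + b ∈ R) := by
  by_cases h₁ : ⟪x, b⟫ < 0
  · exact .inl (hR.add_mem_of_inner_neg hx hb h₁)
  by_cases h₂ : ⟪a, b⟫ < 0
  · exact .inr (hR.add_mem_of_inner_neg ha hb h₂)
  by_cases h₃ : 0 < ⟪x + a + b, x⟫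
  · right
    convert hR.sub_mem_of_inner_pos hxab hx h₃ using 2 <;> abel
  by_cases h₄ : 0 < ⟪x + a + b, a⟫
  · left
    convert hR.sub_mem_of_inner_pos hxab ha h₄ using 2 <;> abel
  exfalso
  have hpos : 0 < ⟪x + a, x + a⟫ := real_inner_self_pos.mpr fun h0 => hR.2.1 (h0 ▸ hxa)
  have e₁ : ⟪x + a + b, x⟫ + ⟪x + a + b, a⟫ = ⟪x + a, x + a⟫ + (⟪x, b⟫ + ⟪a, b⟫) := by
    rw [← inner_add_right, inner_add_left (x + a) b, ← inner_add_left x a b,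
      real_inner_comm b (x + a)]
  linarith

theorem map_list_sum_nonpos {M : Type*} [AddCommGroup M] [Module ℝ M] {f : M →ₗ[ℝ] ℝ}
    {l : List M} (h : ∀ a ∈ l, f a ≤ 0) : f l.sum ≤ 0 := by
  induction l with
  | nil => simp
  | cons a l ih =>
    rw [List.forall_mem_cons] at h
    rw [List.sum_cons, map_add]
    exact add_nonpos h.1 (ih h.2)

/-- All partial sums of `x + l₁ + l₂ + ⋯`, including `x` itself, lie in `R`. -/
def IsSumPath {V : Type*} [AddCommMonoid V] (R : Set V) : V → List V → Prop
  | x, [] => x ∈ R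
  | x, a :: l => x ∈ R ∧ IsSumPath R (x + a) l

namespace IsSumPath

variable {M : Type*} [AddCommMonoid M] {R : Set M}

theorem head_mem {x : M} {l : List M} (h : IsSumPath R x l) : x ∈ R := by
  cases l with
  | nil => exact h
  | cons a l => exact h.1

theorem append_iff {x : M} {p l : List M} :
    IsSumPath R x (p ++ l) ↔ IsSumPath R x p ∧ IsSumPath R (x + p.sum) l := by
  induction p generalizing x with
  | nil =>
    simp only [List.nil_append, List.sum_nil, add_zero]
    exact ⟨fun h => ⟨h.head_mem, h⟩, fun h => h.2⟩
  | cons a p ih =>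
    simp only [List.cons_append, IsSumPath, List.sum_cons, ih, add_assoc, and_assoc]

theorem iff_take {x : M} {l : List M} :
    IsSumPath R x l ↔ ∀ h ≤ l.length, x + (l.take h).sum ∈ R := by
  induction l generalizing x with
  | nil => simp [IsSumPath]
  | cons a l ih =>
    rw [IsSumPath, ih]
    constructor
    · rintro ⟨h0, h1⟩ (_ | h) hh
      · simpa using h0
      · simpa [add_assoc] using h1 h (by simpa using hh)
    · intro H
      refine ⟨by simpa using H 0 (by simp), fun h hh => ?_⟩
      simpa [add_assoc] using H (h + 1) (by simpa using hh)

theorem sum_mem {x : M} {l : List M} (h : IsSumPath R x l) : x + l.sum ∈ R := by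
  simpa using iff_take.mp h l.length le_rfl

end IsSumPath

/-- The list form of a Levi chain, with `ξ` and `η = ξ ∘ σ` as the two height functionals. -/
structure IsLeviList {V : Type*} [AddCommGroup V] [Module ℝ V] (R : Set V) (ξ η : V →ₗ[ℝ] ℝ)
    (β : V) (l : List V) : Prop where
  mem : ∀ a ∈ l, a ∈ R
  nonpos : ∀ a ∈ l, η a ≤ 0
  path : IsSumPath R β l
  pos : 0 < ξ (β + l.sum)
  pos' : 0 < η (β + l.sum)

theorem isLeviChain_iff_isLeviList_ofFn {V : Type*} [NormedAddCommGroup V] [InnerProductSpace ℝ V]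
    {R : Set V} {ξ : V →ₗ[ℝ] ℝ} {σ : V →ₗ[ℝ] V} (hσR : ∀ a ∈ R, σ a ∈ R) {β : V}
    (hβ : β ∈ R) {k : ℕ} (α : Fin k → V) :
    IsLeviChain R {a ∈ R | ξ a ≤ 0} σ β α ↔ IsLeviList R ξ (ξ ∘ₗ σ) β (List.ofFn α) := by
  have hps : ∀ h, partialSum β α h = β + ((List.ofFn α).take h).sum := fun h => by
    rw [List.sum_take_ofFn, partialSum]
  have hlast : partialSum β α k = β + (List.ofFn α).sum := by
    rw [hps, List.take_of_length_le (by simp)]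
  have hpath : IsSumPath R β (List.ofFn α) ↔ ∀ h, 1 ≤ h → h ≤ k → partialSum β α h ∈ R := by
    simp only [IsSumPath.iff_take, hps, List.length_ofFn]
    refine ⟨fun H h _ hk => H h hk, fun H h hk => ?_⟩
    obtain rfl | h1 := Nat.eq_zero_or_pos h
    · simpa using hβ
    · exact H h h1 hk
  constructor
  · rintro ⟨h1, h2, h3, h4⟩
    have hp := hpath.mpr h2
    rw [hlast] at h3 h4
    refine ⟨?_, ?_, hp, ?_, ?_⟩
    · simpa [List.forall_mem_ofFn_iff] using fun i => (h1 i).1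
    · simpa [List.forall_mem_ofFn_iff] using fun i => (h1 i).2.2
    · exact not_le.mp fun h => h3 ⟨hp.sum_mem, h⟩
    · exact not_le.mp fun h => h4 ⟨hσR _ hp.sum_mem, h⟩
  · rintro ⟨h1, h2, h3, h4, h5⟩
    rw [List.forall_mem_ofFn_iff] at h1 h2
    refine ⟨fun i => ⟨h1 i, hσR _ (h1 i), h2 i⟩, hpath.mp h3, ?_, ?_⟩ <;> rw [hlast]
    · exact fun h => h4.not_ge h.2
    · exact fun h => h5.not_ge h.2

/-- A Levi chain, in list form, of minimal length. -/
structure IsMinLeviList {V : Type*} [AddCommGroup V] [Module ℝ V] (R : Set V) (ξ η : V →ₗ[ℝ] ℝ)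
    (β : V) (l : List V) : Prop extends IsLeviList R ξ η β l where
  length_le : ∀ l', IsLeviList R ξ η β l' → l.length ≤ l'.length

namespace IsMinLeviList

section Module

variable {M : Type*} [AddCommGroup M] [Module ℝ M] {R : Set M} {ξ η : M →ₗ[ℝ] ℝ} {β : M}

theorem add_notMem {p s : List M} {a b : M} (h : IsMinLeviList R ξ η β (p ++ a :: b :: s)) :
    a + b ∉ R := by
  intro hab
  obtain ⟨hp, hs⟩ := IsSumPath.append_iff.mp h.path
  have hsum : (p ++ (a + b) :: s).sum = (p ++ a :: b :: s).sum := by simp [add_assoc]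
  have ha := h.nonpos a (by simp)
  have hb := h.nonpos b (by simp)
  have := h.length_le (p ++ (a + b) :: s)
    { mem := fun c hc => by
        have := h.mem c
        simp only [List.mem_append, List.mem_cons] at hc this
        obtain hc | rfl | hc := hc <;> tauto
      nonpos := fun c hc => by
        have := h.nonpos c
        simp only [List.mem_append, List.mem_cons] at hc this
        obtain hc | rfl | hc := hc
        · tauto
        · rw [map_add]; linarith
        · tauto
      path := IsSumPath.append_iff.mpr ⟨hp, hs.1, by simpa [add_assoc] using hs.2.2⟩
      pos := hsum ▸ h.pos
      pos' := hsum ▸ h.pos' }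
  simp at this

theorem add_ne_zero {p s : List M} {a b : M} (h : IsMinLeviList R ξ η β (p ++ a :: b :: s)) :
    a + b ≠ 0 := by
  intro hab
  obtain ⟨hp, hs⟩ := IsSumPath.append_iff.mp h.path
  have hsum : (p ++ s).sum = (p ++ a :: b :: s).sum := by simp [← add_assoc a, hab]
  have := h.length_le (p ++ s)
    { mem := fun c hc => h.mem c (by simp only [List.mem_append, List.mem_cons] at hc ⊢; tauto)
      nonpos := fun c hc =>
        h.nonpos c (by simp only [List.mem_append, List.mem_cons] at hc ⊢; tauto)
      path := IsSumPath.append_iff.mpr ⟨hp, by simpa [add_assoc, hab] using hs.2.2⟩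
      pos := hsum ▸ h.pos
      pos' := hsum ▸ h.pos' }
  simp at this

end Module

variable {E : Type*} [NormedAddCommGroup E] [InnerProductSpace ℝ E] {R : Set E}
  {ξ η : E →ₗ[ℝ] ℝ} {β : E}

theorem swap (hR : IsRootSystem R) {p s : List E} {a b : E}
    (h : IsMinLeviList R ξ η β (p ++ a :: b :: s)) :
    IsMinLeviList R ξ η β (p ++ b :: a :: s) := by
  have hperm : (p ++ b :: a :: s).Perm (p ++ a :: b :: s) := (List.Perm.swap a b s).append_left p
  obtain ⟨hp, hx, hxa, hs⟩ := IsSumPath.append_iff.mp h.path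
  have hη : 0 < η (β + p.sum + b) := by
    have hs_nonpos : η s.sum ≤ 0 := map_list_sum_nonpos fun c hc => h.nonpos c (by simp [hc])
    have ha := h.nonpos a (by simp)
    have htot := h.pos'
    simp only [List.sum_append, List.sum_cons, map_add] at htot ⊢
    linarith
  have hne : β + p.sum + b ≠ 0 := fun h0 => by simp [h0] at hη
  have hxb : β + p.sum + b ∈ R := by
    obtain (h' | h') | (h' | h') := hR.add_mem_or_add_mem hx (h.mem a (by simp))
      (h.mem b (by simp)) hxa hs.head_mem
    · exact absurd h' hne
    · exact h'
    · exact absurd h' h.add_ne_zero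
    · exact absurd h' h.add_notMem
  exact
    { mem := fun c hc => h.mem c (hperm.mem_iff.mp hc)
      nonpos := fun c hc => h.nonpos c (hperm.mem_iff.mp hc)
      path := IsSumPath.append_iff.mpr ⟨hp, hx, hxb, by rwa [add_right_comm]⟩
      pos := hperm.sum_eq ▸ h.pos
      pos' := hperm.sum_eq ▸ h.pos'
      length_le := hperm.length_eq ▸ h.length_le }

theorem append_perm (hR : IsRootSystem R) {l l' : List E} (hl : l.Perm l') (p : List E)
    (h : IsMinLeviList R ξ η β (p ++ l)) : IsMinLeviList R ξ η β (p ++ l') := by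
  induction hl generalizing p with
  | nil => exact h
  | cons x _ ih => simpa using ih (p ++ [x]) (by simpa using h)
  | swap x y l => exact h.swap hR
  | trans _ _ ih₁ ih₂ => exact ih₂ p (ih₁ p h)

theorem perm (hR : IsRootSystem R) {l l' : List E} (h : IsMinLeviList R ξ η β l)
    (hl : l.Perm l') : IsMinLeviList R ξ η β l' :=
  append_perm hR hl [] h

theorem pos_of_mem (hR : IsRootSystem R) {l : List E} (h : IsMinLeviList R ξ η β l) {a : E}
    (ha : a ∈ l) : 0 < ξ a := by
  obtain ⟨s, t, rfl⟩ := List.append_of_mem ha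
  have h' : IsMinLeviList R ξ η β ((s ++ t) ++ [a]) :=
    h.perm hR (List.perm_middle.trans (List.perm_append_singleton a (s ++ t)).symm)
  by_contra! hξ
  have hη := h'.nonpos a (by simp)
  have hpos := h'.pos
  have hpos' := h'.pos'
  rw [List.sum_append, List.sum_singleton, ← add_assoc, map_add] at hpos hpos'
  have := h'.length_le (s ++ t)
    { mem := fun c hc => h'.mem c (List.mem_append_left _ hc)
      nonpos := fun c hc => h'.nonpos c (List.mem_append_left _ hc)
      path := (IsSumPath.append_iff.mp h'.path).1
      pos := by linarith
      pos' := by linarith }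
  simp at this

end IsMinLeviList

/-- Properties of a minimal-length Levi chain: (i) each `αᵢ ∉ Q`; (ii) the proper
partial sums lie in `Q` with conjugate outside `Q`; (iii) any permutation of the
chain is again a Levi chain; (iv) no two distinct terms add up to a root. -/
theorem leviChain_min_properties
    (R : Set V) (hR : IsRootSystem R)
    (ξ : V →ₗ[ℝ] ℝ) (hξ : ∀ α ∈ R, ∃ n : ℤ, ξ α = (n : ℝ))
    (Q : Set V) (hQ : Q = {α ∈ R | ξ α ≤ 0})
    (σ : V →ₗ[ℝ] V) (hσ : σ ∘ₗ σ = LinearMap.id) (hσR : σ '' R = R)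
    (β : V) (hβ : β ∈ Q) (hσβ : σ β ∉ Q)
    (k : ℕ) (α : Fin k → V) (hchain : IsLeviChain R Q σ β α)
    (hmin : ∀ (m : ℕ) (α' : Fin m → V), IsLeviChain R Q σ β α' → k ≤ m) :
    (∀ i, α i ∉ Q ∧ 0 < ξ (α i)) ∧
      (∀ h : ℕ, 1 ≤ h → h < k → partialSum β α h ∈ Q ∧ σ (partialSum β α h) ∉ Q) ∧
      (∀ τ : Equiv.Perm (Fin k), IsLeviChain R Q σ β (α ∘ τ)) ∧
      ∀ i j : Fin k, i ≠ j → α i + α j ∉ R := by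
  subst hQ
  have hσR' : ∀ a ∈ R, σ a ∈ R := fun a ha => hσR ▸ Set.mem_image_of_mem σ ha
  have hiff := fun {m : ℕ} (α' : Fin m → V) =>
    isLeviChain_iff_isLeviList_ofFn (ξ := ξ) hσR' hβ.1 α'
  have hl : IsMinLeviList R ξ (ξ ∘ₗ σ) β (List.ofFn α) :=
    { (hiff α).mp hchain with
      length_le := fun l' hl' => by
        rw [List.length_ofFn]
        exact hmin l'.length l'.get ((hiff _).mpr (by rwa [List.ofFn_get])) }
  have hpos : ∀ i, 0 < ξ (α i) := fun i => hl.pos_of_mem hR (by simp)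
  refine ⟨fun i => ⟨fun h => (hpos i).not_ge h.2, hpos i⟩, fun h h1 hk => ?_, fun τ => ?_,
    fun i j hij => ?_⟩
  · have hmem := hchain.2.1 h h1 hk.le
    have hsplit : partialSum β α h + ((List.ofFn α).drop h).sum = β + (List.ofFn α).sum := by
      rw [partialSum, ← List.sum_take_ofFn, add_assoc, List.sum_take_add_sum_drop]
    have hps : partialSum β α h = β + ((List.ofFn α).take h).sum := by
      rw [List.sum_take_ofFn, partialSum]
    have hdrop : (ξ ∘ₗ σ) ((List.ofFn α).drop h).sum ≤ 0 :=
      map_list_sum_nonpos fun c hc => hl.nonpos c (List.mem_of_mem_drop hc)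
    have hη : 0 < (ξ ∘ₗ σ) (partialSum β α h) := by
      have := hl.pos'
      rw [← hsplit, map_add] at this
      linarith
    refine ⟨⟨hmem, ?_⟩, fun h' => hη.not_ge h'.2⟩
    by_contra! hξpos
    have hpath := hl.path
    rw [← List.take_append_drop h (List.ofFn α), IsSumPath.append_iff] at hpath
    have := hl.length_le ((List.ofFn α).take h)
      { mem := fun c hc => hl.mem c (List.mem_of_mem_take hc)
        nonpos := fun c hc => hl.nonpos c (List.mem_of_mem_take hc)
        path := hpath.1
        pos := hps ▸ hξpos
        pos' := hps ▸ hη }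
    simp only [List.length_take, List.length_ofFn] at this
    omega
  · exact (hiff _).mpr (hl.perm hR (Equiv.Perm.ofFn_comp_perm τ α).symm).toIsLeviList
  · have hperm : (List.finRange k).Perm (i :: j :: ((List.finRange k).erase i).erase j) :=
      (List.perm_cons_erase (List.mem_finRange i)).trans <| .cons _ <|
        List.perm_cons_erase <| (List.mem_erase_of_ne hij.symm).mpr (List.mem_finRange j)
    have h' := hperm.map α
    rw [← List.ofFn_eq_map] at h'
    exact IsMinLeviList.add_notMem (p := []) (hl.perm hR h')
end

section
/- If β ∈ R satisfies ξ(β) = 0 and σ(β) ∉ Q, then the Levi order q^σ(β) is either 1 or +∞. -/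
open RealInnerProductSpace

variable {V : Type*} [NormedAddCommGroup V] [InnerProductSpace ℝ V]

namespace IsRootSystem

variable {R : Set V}

theorem neg_mem_s6 (hR : IsRootSystem R) {x : V} (hx : x ∈ R) : -x ∈ R := by
  obtain ⟨-, h0, h, -⟩ := hR
  have hx0 : (⟪x, x⟫ : ℝ) ≠ 0 := inner_self_ne_zero.2 fun h => h0 (h ▸ hx)
  have hmem := (h x hx x hx).2
  rw [mul_div_assoc, div_self hx0, mul_one, two_smul, sub_add_cancel_left] at hmem
  exact hmem

/-- The sum of two roots with negative inner product is a root or zero. -/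
theorem add_mem_or_eq_zero (hR : IsRootSystem R) {x y : V} (hx : x ∈ R) (hy : y ∈ R)
    (hxy : (⟪x, y⟫ : ℝ) < 0) : x + y ∈ R ∨ x + y = 0 := by
  obtain ⟨-, h0, h, -⟩ := hR
  have hpos : ∀ z ∈ R, (0 : ℝ) < ⟪z, z⟫ := fun z hz =>
    real_inner_self_pos.2 fun h => h0 (h ▸ hz)
  have key : ∀ u ∈ R, ∀ v ∈ R, (⟪v, u⟫ : ℝ) < 0 →
      v + u ∈ R ∨ (⟪v, u⟫ : ℝ) ≤ -⟪u, u⟫ := by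
    intro u hu v hv huv
    obtain ⟨⟨n, hn⟩, hmem⟩ := h u hu v hv
    rw [hn] at hmem
    rw [div_eq_iff (hpos u hu).ne'] at hn
    have hu' := hpos u hu
    have hn0 : n < 0 := by
      have : (n : ℝ) < 0 := by
        by_contra hneg
        nlinarith [mul_nonneg (not_lt.1 hneg) hu'.le]
      exact_mod_cast this
    rcases eq_or_ne n (-1) with rfl | hne
    · left
      simpa using hmem
    · right
      have : (n : ℝ) ≤ -2 := by
        have : n ≤ -2 := by omega
        exact_mod_cast this
      nlinarith [mul_le_mul_of_nonneg_right this hu'.le]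
  rcases key y hy x hx hxy with h1 | h1
  · exact Or.inl h1
  rcases key x hx y hy (by rwa [real_inner_comm]) with h2 | h2
  · exact Or.inl (add_comm x y ▸ h2)
  right
  rw [real_inner_comm] at h2
  refine inner_self_eq_zero.1 (le_antisymm ?_ (real_inner_self_nonneg (x := x + y)))
  rw [real_inner_add_add_self]
  linarith

/-- If `x`, `y`, `z`, `x + y` and `x + y + z` are roots, then `x + z` or `y + z` is a root
or zero. -/
theorem add_mem_or_add_mem_s6 (hR : IsRootSystem R) {x y z : V} (hx : x ∈ R) (hy : y ∈ R)
    (hz : z ∈ R) (hxy : x + y ∈ R) (hxyz : x + y + z ∈ R) :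
    (x + z ∈ R ∨ x + z = 0) ∨ (y + z ∈ R ∨ y + z = 0) := by
  by_cases hxz : (⟪x, z⟫ : ℝ) < 0
  · exact Or.inl (hR.add_mem_or_eq_zero hx hz hxz)
  by_cases hyz : (⟪y, z⟫ : ℝ) < 0
  · exact Or.inr (hR.add_mem_or_eq_zero hy hz hyz)
  by_cases hwx : (⟪x + y + z, x⟫ : ℝ) > 0
  · have := hR.add_mem_or_eq_zero hxyz (hR.neg_mem_s6 hx) (by rw [inner_neg_right]; linarith)
    rw [show x + y + z + -x = y + z by abel] at this
    exact Or.inr this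
  by_cases hwy : (⟪x + y + z, y⟫ : ℝ) > 0
  · have := hR.add_mem_or_eq_zero hxyz (hR.neg_mem_s6 hy) (by rw [inner_neg_right]; linarith)
    rw [show x + y + z + -y = x + z by abel] at this
    exact Or.inl this
  exfalso
  have hpos : (0 : ℝ) < ⟪x + y, x + y⟫ :=
    real_inner_self_pos.2 fun h => hR.2.1 (h ▸ hxy)
  simp only [inner_add_left, inner_add_right, real_inner_comm x z, real_inner_comm y z] at *
  linarith [real_inner_comm x z, real_inner_comm y z]

end IsRootSystem

/-- Successively adding the entries of a list of roots, on each of which `b` is nonpositive,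
to `β` stays inside `R` and ends at a vector on which `b` is positive. -/
def IsDescendingPath (R : Set V) (b : V →ₗ[ℝ] ℝ) : V → List V → Prop
  | β, [] => 0 < b β
  | β, x :: l => x ∈ R ∧ b x ≤ 0 ∧ β + x ∈ R ∧ IsDescendingPath R b (β + x) l

theorem IsDescendingPath.pos {R : Set V} {b : V →ₗ[ℝ] ℝ} {β : V} {l : List V}
    (h : IsDescendingPath R b β l) : 0 < b β := by
  induction l generalizing β with
  | nil => exact h
  | cons x l ih =>
    have := ih h.2.2.2
    rw [map_add] at this
    linarith [h.2.1]

/-- A descending path along which `a` increases overall can be replaced by one, at most as long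
and with the same sum, whose first step increases `a`. -/
theorem IsDescendingPath.exists_pos_head {R : Set V} (hR : IsRootSystem R)
    {a b : V →ₗ[ℝ] ℝ} {β : V} (hβ : β ∈ R) {l : List V} (h : IsDescendingPath R b β l)
    (hl : 0 < a l.sum) :
    ∃ x m, 0 < a x ∧ IsDescendingPath R b β (x :: m) ∧ (x :: m).length ≤ l.length ∧
      (x :: m).sum = l.sum := by
  induction hn : l.length using Nat.strong_induction_on generalizing β l with
  | _ n ih =>
  subst hn
  match l, h, hl, ih with
  | [], _, hl, _ => simp at hl
  | x :: l, h, hl, ih =>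
    by_cases hx : 0 < a x
    · exact ⟨x, l, hx, h, le_rfl, rfl⟩
    obtain ⟨hxR, hbx, hβx, hpath⟩ := h
    rw [List.sum_cons, map_add] at hl
    obtain ⟨y, m, hy, ⟨hyR, hby, hβxy, hm⟩, hlen, hsum⟩ :=
      ih l.length (by simp) hβx hpath (by linarith) rfl
    simp only [List.length_cons, List.sum_cons] at hlen hsum ⊢
    rw [← hsum, map_add] at hl
    have hbpos := hm.pos
    simp only [map_add] at hbpos
    rcases hR.add_mem_or_add_mem_s6 hβ hxR hyR hβx hβxy with (hβy | hβy) | (hxy | hxy)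
    · refine ⟨y, x :: m, hy, ⟨hyR, hby, hβy, hxR, hbx, ?_, ?_⟩, by simpa using hlen, ?_⟩
      · rwa [add_right_comm]
      · rwa [add_right_comm]
      · rw [← hsum, List.sum_cons, add_left_comm]
    · have := congrArg b hβy
      rw [map_add, map_zero] at this
      linarith
    · obtain ⟨z, m', hz, hm', hlen', hsum'⟩ :=
        ih (m.length + 1) (by simp; omega) hβ (l := (x + y) :: m)
          ⟨hxy, by rw [map_add]; linarith, by rwa [← add_assoc], by rwa [← add_assoc]⟩
          (by simp only [List.sum_cons, map_add]; linarith) rfl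
      simp only [List.length_cons, List.sum_cons] at hlen' hsum'
      exact ⟨z, m', hz, hm', by omega, by rw [hsum', ← hsum, add_assoc]⟩
    · rw [add_assoc, hxy, add_zero] at hm
      have hxy' := congrArg a hxy
      rw [map_add, map_zero] at hxy'
      obtain ⟨z, m', hz, hm', hlen', hsum'⟩ :=
        ih m.length (by simp; omega) hβ hm (by linarith) rfl
      simp only [List.length_cons, List.sum_cons] at hlen' hsum'
      exact ⟨z, m', hz, hm', by omega, by rw [hsum', ← hsum, ← add_assoc, hxy, zero_add]⟩

omit [InnerProductSpace ℝ V] in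
theorem partialSum_zero (β : V) {k : ℕ} (α : Fin k → V) : partialSum β α 0 = β := by
  simp [partialSum]

omit [InnerProductSpace ℝ V] in
theorem partialSum_succ (β : V) {k : ℕ} (α : Fin (k + 1) → V) (h : ℕ) :
    partialSum β α (h + 1) = partialSum (β + α 0) (fun i => α i.succ) h := by
  simp [partialSum, Finset.sum_filter, Fin.sum_univ_succ, add_assoc]

omit [InnerProductSpace ℝ V] in
theorem partialSum_eq_add_sum_ofFn (β : V) {k : ℕ} (α : Fin k → V) :
    partialSum β α k = β + (List.ofFn α).sum := by
  simp [partialSum, List.sum_ofFn]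

theorem isDescendingPath_ofFn {R : Set V} {b : V →ₗ[ℝ] ℝ} {β : V} {k : ℕ} {α : Fin k → V}
    (hα : ∀ i, α i ∈ R ∧ b (α i) ≤ 0)
    (hsum : ∀ h : ℕ, 1 ≤ h → h ≤ k → partialSum β α h ∈ R)
    (hpos : 0 < b (partialSum β α k)) : IsDescendingPath R b β (List.ofFn α) := by
  induction k generalizing β with
  | zero =>
    rw [partialSum_zero] at hpos
    rw [List.ofFn_zero]
    exact hpos
  | succ k ih =>
    rw [List.ofFn_succ]
    refine ⟨(hα 0).1, (hα 0).2, ?_, ih (fun i => hα i.succ) (fun h _ hk => ?_) ?_⟩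
    · have := hsum 1 le_rfl (by omega)
      rwa [partialSum_succ, partialSum_zero] at this
    · rw [← partialSum_succ]
      exact hsum (h + 1) (by omega) (by omega)
    · rwa [← partialSum_succ]

/-- If `β ∈ R` satisfies `ξ(β) = 0` and `σ(β) ∉ Q`, then the Levi order
`q^σ(β)` is either `1` or `+∞`. -/
theorem leviOrder_eq_one_or_top
    (R : Set V) (hR : IsRootSystem R)
    (ξ : V →ₗ[ℝ] ℝ) (hξ : ∀ α ∈ R, ∃ n : ℤ, ξ α = (n : ℝ))
    (Q : Set V) (hQ : Q = {α ∈ R | ξ α ≤ 0})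
    (σ : V →ₗ[ℝ] V) (hσ : σ ∘ₗ σ = LinearMap.id) (hσR : σ '' R = R)
    (β : V) (hβR : β ∈ R) (hξβ : ξ β = 0) (hσβ : σ β ∉ Q) :
    leviOrder R Q σ β = 1 ∨ leviOrder R Q σ β = ⊤ := by
  subst hQ
  have hσmem : ∀ {x}, x ∈ R → σ x ∈ R := fun hx => hσR ▸ Set.mem_image_of_mem σ hx
  by_cases hex : ∃ (k : ℕ) (α : Fin k → V), IsLeviChain R {α ∈ R | ξ α ≤ 0} σ β α
  · left
    obtain ⟨k, α, hα, hsum, hγ, hσγ⟩ := hex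
    have hk : 1 ≤ k := by
      by_contra hk
      obtain rfl : k = 0 := by omega
      rw [partialSum_zero] at hγ
      exact hγ ⟨hβR, hξβ.le⟩
    have hγR := hsum k hk le_rfl
    have ha : 0 < ξ (partialSum β α k) := not_le.1 fun h => hγ ⟨hγR, h⟩
    have hb : 0 < (ξ ∘ₗ σ) (partialSum β α k) := not_le.1 fun h => hσγ ⟨hσmem hγR, h⟩
    have hpath := isDescendingPath_ofFn (b := ξ ∘ₗ σ)
      (fun i => ⟨(hα i).1, (hα i).2.2⟩) hsum hb
    rw [partialSum_eq_add_sum_ofFn, map_add, hξβ, zero_add] at ha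
    obtain ⟨x, m, hx, ⟨hxR, hbx, hβx, hm⟩, -, -⟩ := hpath.exists_pos_head hR hβR ha
    have hone : partialSum β (fun _ : Fin 1 => x) 1 = β + x := by
      rw [partialSum_succ, partialSum_zero]
    apply le_antisymm
    · refine sInf_le ⟨1, fun _ => x, rfl, fun _ => ⟨hxR, hσmem hxR, hbx⟩,
        fun h h1 h2 => ?_, ?_, ?_⟩
      · obtain rfl : h = 1 := le_antisymm h2 h1
        rwa [hone]
      · rw [hone]
        rintro ⟨-, h⟩
        rw [map_add] at h
        linarith
      · rw [hone]
        exact fun h => not_lt.2 h.2 hm.pos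
    · refine le_sInf ?_
      rintro _ ⟨j, δ, rfl, -, -, hδ, -⟩
      rw [Nat.one_le_cast, Nat.one_le_iff_ne_zero]
      rintro rfl
      rw [partialSum_zero] at hδ
      exact hδ ⟨hβR, hξβ.le⟩
  · right
    refine sInf_eq_top.2 ?_
    rintro _ ⟨k, α, -, hα⟩
    exact absurd ⟨k, α, hα⟩ hex
end
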